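/- Let N(u) denote the number of nontrivial zeros ρ = β + iγ of the Riemann zeta function with 0 < γ ≤ u. Assume Backlund's bound |N(u) − (u/2π)log(u/(2πe))| ≤ 0.137 log u + 0.443 log log u + 5.225 for u ≥ 14.134725146. Then Σ_{ρ: |γ| ≥ 1} 1/γ² ≤ 0.098178, where the sum runs over all nontrivial zeros of ζ counted with multiplicity. -/

import Mathlib

open Complex Filter Topology Asymptotics Bornology Set ComplexConjugate

/-- A Phragmén–Lindelöf bound in the right half-plane, sharpened by the Blaschke factors of
finitely many zeros. -/
theorem norm_mul_prod_le_of_zeros {U : Set ℂ} (hU : IsOpen U) (hsub : ∀ z : ℂ, 0 ≤ z.re → z ∈ U)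
    {C : ℝ} (F : Finset ℂ) (hF : ∀ a ∈ F, 0 < a.re) :
    ∀ f : ℂ → ℂ, DifferentiableOn ℂ f U →
    (∃ c < (2 : ℝ), ∃ B, f =O[cobounded ℂ ⊓ 𝓟 {z | 0 < z.re}] fun z => Real.exp (B * ‖z‖ ^ c)) →
    IsBoundedUnder (· ≤ ·) atTop (fun x : ℝ => ‖f x‖) →
    (∀ x : ℝ, ‖f (x * I)‖ ≤ C) → (∀ a ∈ F, f a = 0) →
    ∀ z : ℂ, 0 ≤ z.re → ‖f z‖ * ∏ a ∈ F, ‖z + conj a‖ ≤ C * ∏ a ∈ F, ‖z - a‖ := by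
  induction F using Finset.induction_on with
  | empty =>
    intro f hd hexp hre him _ z hz
    have hcl : closure {z : ℂ | 0 < z.re} ⊆ U := by
      rw [closure_setOfPred_lt_re]
      exact fun z hz => hsub z hz
    simpa using PhragmenLindelof.right_half_plane_of_bounded_on_real
      (hd.mono hcl).diffContOnCl hexp hre him hz
  | insert a F ha ih =>
    intro f hd hexp hre him h0 z hz
    have hapos : 0 < a.re := hF a (by simp)
    have hfa : f a = 0 := h0 a (by simp)
    set Q : ℂ → ℂ := fun w => dslope f a w * (w + conj a) with hQ
    have hmul : ∀ w, (w - a) * Q w = f w * (w + conj a) := fun w => by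
      have := sub_smul_dslope_of_zero hfa w
      rw [smul_eq_mul] at this
      rw [hQ, ← this]
      ring
    have hnorm : ∀ w, ‖w - a‖ * ‖Q w‖ = ‖f w‖ * ‖w + conj a‖ := fun w => by
      rw [← norm_mul, hmul, norm_mul]
    have hbig : ∀ w : ℂ, 3 * ‖a‖ < ‖w‖ → ‖Q w‖ ≤ 2 * ‖f w‖ := fun w hw => by
      have h1 : ‖w‖ - ‖a‖ ≤ ‖w - a‖ := norm_sub_norm_le w a
      have h2 : ‖w + conj a‖ ≤ ‖w‖ + ‖a‖ := by
        simpa using norm_add_le w (conj a)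
      have h3 := hnorm w
      have h4 := norm_nonneg a
      have h5 : ‖w - a‖ * ‖Q w‖ ≤ ‖w - a‖ * (2 * ‖f w‖) := by
        rw [h3]
        nlinarith [norm_nonneg (f w)]
      exact le_of_mul_le_mul_left h5 (by linarith)
    have hQd : DifferentiableOn ℂ Q U := by
      have : DifferentiableOn ℂ (dslope f a) U :=
        (differentiableOn_dslope (hU.mem_nhds (hsub a hapos.le))).2 hd
      exact this.mul (by fun_prop)
    have hQO : Q =O[cobounded ℂ ⊓ 𝓟 {z | 0 < z.re}] f := by
      refine IsBigO.of_bound 2 (Filter.Eventually.filter_mono inf_le_left ?_)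
      filter_upwards [tendsto_norm_cobounded_atTop.eventually_gt_atTop (3 * ‖a‖)] with w hw
      exact hbig w hw
    have hQre : IsBoundedUnder (· ≤ ·) atTop (fun x : ℝ => ‖Q x‖) := by
      obtain ⟨b, hb⟩ := hre
      refine ⟨2 * b, ?_⟩
      rw [eventually_map] at hb ⊢
      filter_upwards [hb, eventually_gt_atTop (3 * ‖a‖)] with x hx hxa
      have := hbig x (by
        rw [Complex.norm_real]
        exact hxa.trans_le (le_abs_self x))
      linarith
    have hQim : ∀ x : ℝ, ‖Q (x * I)‖ ≤ C := fun x => by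
      have h1 : ‖(x * I : ℂ) + conj a‖ = ‖(x * I : ℂ) - a‖ := by
        rw [← norm_neg ((x * I : ℂ) - a), ← Complex.norm_conj (-((x * I : ℂ) - a))]
        congr 1
        simp
        ring
      have h2 : 0 < ‖(x * I : ℂ) - a‖ := by
        rw [norm_pos_iff, sub_ne_zero]
        rintro h
        rw [← h] at hapos
        simp at hapos
      have h3 := hnorm (x * I)
      rw [h1, mul_comm] at h3
      rw [mul_right_cancel₀ h2.ne' h3]
      exact him x
    have hQ0 : ∀ b ∈ F, Q b = 0 := fun b hb => by
      have hba : b - a ≠ 0 := by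
        rw [sub_ne_zero]
        rintro rfl
        exact ha hb
      have := hmul b
      rw [h0 b (by simp [hb]), zero_mul] at this
      exact (mul_eq_zero.1 this).resolve_left hba
    obtain ⟨c, hc, B, hO⟩ := hexp
    have key := ih (fun b hb => hF b (by simp [hb])) Q hQd ⟨c, hc, B, hQO.trans hO⟩ hQre hQim hQ0
      z hz
    rw [Finset.prod_insert ha, Finset.prod_insert ha]
    calc ‖f z‖ * (‖z + conj a‖ * ∏ b ∈ F, ‖z + conj b‖)
        = ‖z - a‖ * (‖Q z‖ * ∏ b ∈ F, ‖z + conj b‖) := by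
          rw [← mul_assoc, ← hnorm, mul_assoc]
      _ ≤ ‖z - a‖ * (C * ∏ b ∈ F, ‖z - b‖) := by gcongr
      _ = _ := by ring

/-- The trapezoidal Euler–Maclaurin remainder of `x ↦ (s - 1) * x ^ (-s)` on `[n + 1, n + 2]`. -/
noncomputable def zetaTrapezoidTerm (n : ℕ) (s : ℂ) : ℂ :=
  (s - 1) * (((n + 1 : ℕ) : ℂ) ^ (-s) + ((n + 2 : ℕ) : ℂ) ^ (-s)) / 2
    + (((n + 2 : ℕ) : ℂ) ^ (1 - s) - ((n + 1 : ℕ) : ℂ) ^ (1 - s))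

lemma norm_zetaTrapezoidTerm_le (n : ℕ) {s : ℂ} (hs : -2 ≤ s.re) :
    ‖zetaTrapezoidTerm n s‖ ≤ ‖s - 1‖ * ‖s‖ * ‖s + 1‖ * ((n + 1 : ℕ) : ℝ) ^ (-s.re - 2) := by
  set m : ℝ := ((n + 1 : ℕ) : ℝ) with hm
  have hm0 : 0 < m := by positivity
  have hpow : ∀ (r : ℂ) (t : ℝ), 0 ≤ t →
      HasDerivAt (fun t : ℝ => ((m + t : ℝ) : ℂ) ^ r) (r * ((m + t : ℝ) : ℂ) ^ (r - 1)) t := by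
    intro r t ht
    have h1 : HasDerivAt (fun z : ℂ => z ^ r) (r * ((m + t : ℝ) : ℂ) ^ (r - 1))
        ((m + t : ℝ) : ℂ) := by
      simpa using (hasDerivAt_id ((m + t : ℝ) : ℂ)).cpow_const (c := r)
        (Or.inl (by simp; linarith))
    have h2 : HasDerivAt (fun t : ℝ => ((m + t : ℝ) : ℂ)) 1 t := by
      simpa using ((hasDerivAt_id t).const_add m).ofReal_comp
    exact (h1.comp t h2).congr_deriv (mul_one _)
  set K : ℝ := ‖s‖ * ‖s + 1‖ * m ^ (-s.re - 2) with hK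
  have hcast : ∀ t : ℝ, HasDerivAt (fun t : ℝ => (t : ℂ)) 1 t := fun t => by
    simpa using (hasDerivAt_id t).ofReal_comp
  set k : ℝ → ℂ := fun t => (m : ℂ) ^ (-s) - ((m + t : ℝ) : ℂ) ^ (-s)
    - s * t * ((m + t : ℝ) : ℂ) ^ (-s - 1) with hk
  have hkd : ∀ t : ℝ, 0 ≤ t →
      HasDerivAt k (s * (s + 1) * t * ((m + t : ℝ) : ℂ) ^ (-s - 2)) t := by
    intro t ht
    have h1 := (((hpow (-s) t ht).const_sub ((m : ℂ) ^ (-s)))).sub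
      (((hcast t).const_mul s).mul (hpow (-s - 1) t ht))
    refine h1.congr_deriv ?_
    rw [show -s - 1 - 1 = -s - 2 by ring]
    ring
  have hkb : ∀ t ∈ Icc (0 : ℝ) 1, ‖k t‖ ≤ K := by
    intro t ht
    have h := norm_image_sub_le_of_norm_deriv_le_segment' (C := K)
      (fun x hx => (hkd x hx.1).hasDerivWithinAt (s := Icc (0 : ℝ) 1)) (by
        intro x hx
        rw [norm_mul, norm_mul, norm_mul,
          Complex.norm_cpow_eq_rpow_re_of_pos (by linarith [hx.1] : 0 < m + x), Complex.norm_real,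
          Real.norm_of_nonneg hx.1]
        have h1 : (m + x) ^ ((-s - 2).re) ≤ m ^ (-s.re - 2) := by
          simp only [sub_re, neg_re, re_ofNat]
          exact Real.rpow_le_rpow_of_nonpos hm0 (by linarith [hx.1]) (by linarith)
        calc ‖s‖ * ‖s + 1‖ * x * (m + x) ^ ((-s - 2).re)
            ≤ ‖s‖ * ‖s + 1‖ * 1 * m ^ (-s.re - 2) := by
              have h2 := hx.2.le
              have h3 : 0 ≤ (m + x) ^ ((-s - 2).re) := Real.rpow_nonneg (by linarith [hx.1]) _
              gcongr
          _ = K := by rw [mul_one]) t ht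
    have h0 : k 0 = 0 := by simp [hk]
    rw [h0, sub_zero] at h
    have hK0 : 0 ≤ K := by positivity
    nlinarith [ht.2]
  set g : ℝ → ℂ := fun t => (s - 1) * t * ((m : ℂ) ^ (-s) + ((m + t : ℝ) : ℂ) ^ (-s)) / 2
    + (((m + t : ℝ) : ℂ) ^ (1 - s) - (m : ℂ) ^ (1 - s)) with hg
  have hgd : ∀ t : ℝ, 0 ≤ t → HasDerivAt g ((s - 1) / 2 * k t) t := by
    intro t ht
    have h1 := ((((hcast t).const_mul (s - 1)).mul
      ((hpow (-s) t ht).const_add ((m : ℂ) ^ (-s)))).div_const 2).add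
      ((hpow (1 - s) t ht).sub_const ((m : ℂ) ^ (1 - s)))
    refine h1.congr_deriv ?_
    simp only [hk]
    rw [show 1 - s - 1 = -s by ring]
    ring
  have h := norm_image_sub_le_of_norm_deriv_le_segment_01' (C := ‖s - 1‖ * K)
      (fun x hx => (hgd x hx.1).hasDerivWithinAt (s := Icc (0 : ℝ) 1)) (by
        intro x hx
        rw [norm_mul, norm_div]
        have := hkb x ⟨hx.1, hx.2.le⟩
        have h2 : ‖s - 1‖ / ‖(2 : ℂ)‖ ≤ ‖s - 1‖ := by
          simp
        gcongr)
  have h0 : g 0 = 0 := by simp [hg]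
  have h1 : g 1 = zetaTrapezoidTerm n s := by
    have : ((m + 1 : ℝ) : ℂ) = ((n + 2 : ℕ) : ℂ) := by
      rw [hm]; push_cast; ring
    have h' : (m : ℂ) = ((n + 1 : ℕ) : ℂ) := by rw [hm]; push_cast; ring
    simp only [hg, zetaTrapezoidTerm, this, h']
    simp
  rw [h0, sub_zero, h1] at h
  rw [hK] at h
  linarith

lemma hasSum_zetaTrapezoidTerm {s : ℂ} (hs : 1 < s.re) :
    HasSum (fun n => zetaTrapezoidTerm n s) (riemannZeta₁ s - (s - 1) / 2 - 1) := by
  have hs1 : s ≠ 1 := by rintro rfl; simp at hs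
  have hs0 : s ≠ 0 := by rintro rfl; simp at hs; linarith
  have hsum0 : Summable (fun n : ℕ => (n : ℂ) ^ (-s)) := by
    simpa [cpow_neg] using (Complex.summable_one_div_nat_cpow (p := s)).2 hs
  have hz0 : HasSum (fun n : ℕ => (n : ℂ) ^ (-s)) (riemannZeta s) := by
    rw [zeta_eq_tsum_one_div_nat_cpow hs]
    simpa [cpow_neg] using hsum0.hasSum
  have hz1 : HasSum (fun n : ℕ => ((n + 1 : ℕ) : ℂ) ^ (-s)) (riemannZeta s) := by
    rw [hasSum_nat_add_iff' 1 |>.symm] at hz0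
    simpa [hs0] using hz0
  have hz2 : HasSum (fun n : ℕ => ((n + 2 : ℕ) : ℂ) ^ (-s)) (riemannZeta s - 1) := by
    rw [hasSum_nat_add_iff' 1 |>.symm] at hz1
    simpa [add_assoc, one_add_one_eq_two] using hz1
  have htend : Tendsto (fun n : ℕ => ((n + 1 : ℕ) : ℂ) ^ (1 - s)) atTop (𝓝 0) := by
    rw [tendsto_zero_iff_norm_tendsto_zero]
    have h1 : Tendsto (fun n : ℕ => (((n + 1 : ℕ) : ℝ)) ^ (-(s.re - 1))) atTop (𝓝 0) :=
      (tendsto_rpow_neg_atTop (by linarith)).comp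
        (tendsto_natCast_atTop_atTop.comp (tendsto_add_atTop_nat 1))
    refine h1.congr fun n => ?_
    rw [Complex.norm_natCast_cpow_of_pos (by positivity)]
    simp
  have htel : HasSum (fun n : ℕ => ((n + 2 : ℕ) : ℂ) ^ (1 - s) - ((n + 1 : ℕ) : ℂ) ^ (1 - s))
      (-1) := by
    have hsm : Summable (fun n : ℕ =>
        ((n + 2 : ℕ) : ℂ) ^ (1 - s) - ((n + 1 : ℕ) : ℂ) ^ (1 - s)) := by
      have hbd : Summable (fun n : ℕ => ‖s - 1‖ * ‖s‖ * ‖s + 1‖ *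
          ((n + 1 : ℕ) : ℝ) ^ (-s.re - 2)) :=
        ((summable_nat_add_iff 1).2 (Real.summable_nat_rpow.2 (by linarith))).mul_left _
      have h1 : Summable (fun n => zetaTrapezoidTerm n s) :=
        Summable.of_norm_bounded hbd fun n => norm_zetaTrapezoidTerm_le n (by linarith)
      have h2 := h1.sub (((hz1.summable.add hz2.summable).mul_left (s - 1)).div_const 2)
      refine h2.congr fun n => ?_
      rw [zetaTrapezoidTerm]
      ring
    rw [hsm.hasSum_iff_tendsto_nat]
    have : ∀ N : ℕ, ∑ n ∈ Finset.range N,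
        (((n + 2 : ℕ) : ℂ) ^ (1 - s) - ((n + 1 : ℕ) : ℂ) ^ (1 - s))
        = ((N + 1 : ℕ) : ℂ) ^ (1 - s) - 1 := fun N => by
      have := Finset.sum_range_sub (fun n : ℕ => ((n + 1 : ℕ) : ℂ) ^ (1 - s)) N
      simpa [add_assoc, one_add_one_eq_two] using this
    simp_rw [this]
    simpa using htend.sub_const 1
  have h := (((hz1.add hz2).mul_left (s - 1)).div_const 2).add htel
  have hsub : s - 1 ≠ 0 := sub_ne_zero.2 hs1
  have hval : (s - 1) * (riemannZeta s + (riemannZeta s - 1)) / 2 + -1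
      = riemannZeta₁ s - (s - 1) / 2 - 1 := by
    rw [riemannZeta_eq_inv_sub_mul hs1]
    field_simp
    ring
  exact hval ▸ h

lemma norm_riemannZeta₁_le : ∃ K : ℝ, ∀ s : ℂ, -1 / 2 ≤ s.re →
    ‖riemannZeta₁ s‖ ≤ K * (1 + ‖s‖) ^ 3 := by
  have hu : Summable (fun n : ℕ => ((n + 1 : ℕ) : ℝ) ^ (-5 / 4 : ℝ)) :=
    (summable_nat_add_iff 1).2 (Real.summable_nat_rpow.2 (by norm_num))
  have hle : ∀ (n : ℕ) (s : ℂ), -3 / 4 < s.re →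
      ‖zetaTrapezoidTerm n s‖ ≤ (1 + ‖s‖) ^ 3 * ((n + 1 : ℕ) : ℝ) ^ (-5 / 4 : ℝ) := by
    intro n s hs
    refine (norm_zetaTrapezoidTerm_le n (by linarith)).trans ?_
    have h1 : ‖s - 1‖ ≤ 1 + ‖s‖ := by
      simpa [add_comm] using norm_sub_le s 1
    have h2 : ‖s + 1‖ ≤ 1 + ‖s‖ := by
      simpa [add_comm] using norm_add_le s 1
    have h3 : ‖s‖ ≤ 1 + ‖s‖ := by linarith
    have h4 : ((n + 1 : ℕ) : ℝ) ^ (-s.re - 2) ≤ ((n + 1 : ℕ) : ℝ) ^ (-5 / 4 : ℝ) :=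
      Real.rpow_le_rpow_of_exponent_le (by simp) (by linarith)
    calc _ ≤ (1 + ‖s‖) * (1 + ‖s‖) * (1 + ‖s‖) * ((n + 1 : ℕ) : ℝ) ^ (-5 / 4 : ℝ) := by gcongr
      _ = _ := by ring
  refine ⟨2 + ∑' n : ℕ, ((n + 1 : ℕ) : ℝ) ^ (-5 / 4 : ℝ), fun s hs => ?_⟩
  have heq : riemannZeta₁ s = (∑' n, zetaTrapezoidTerm n s) + ((s - 1) / 2 + 1) := by
    set R : ℝ := ‖s‖ + 3 with hR
    set U : Set ℂ := {z : ℂ | -3 / 4 < z.re} ∩ Metric.ball 0 R with hU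
    have hUo : IsOpen U := (isOpen_lt continuous_const continuous_re).inter Metric.isOpen_ball
    have hUc : IsPreconnected U :=
      ((convex_halfSpace_re_gt _).inter (convex_ball _ _)).isPreconnected
    have hd : DifferentiableOn ℂ (fun z => ∑' n, zetaTrapezoidTerm n z) U := by
      refine differentiableOn_tsum_of_summable_norm (hu.mul_left ((1 + R) ^ 3)) (fun n => ?_) hUo
        (fun n z hz => (hle n z hz.1).trans ?_)
      · have h1 : ((n + 1 : ℕ) : ℂ) ≠ 0 := Nat.cast_ne_zero.2 (by lia)
        have h2 : ((n + 2 : ℕ) : ℂ) ≠ 0 := Nat.cast_ne_zero.2 (by lia)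
        unfold zetaTrapezoidTerm
        fun_prop (disch := first | exact Or.inl h1 | exact Or.inl h2 | norm_num)
      · have : ‖z‖ ≤ R := (mem_ball_zero_iff.1 hz.2).le
        gcongr
    have hEq := AnalyticOnNhd.eqOn_of_preconnected_of_eventuallyEq (z₀ := 2)
      (differentiable_riemannZeta₁.differentiableOn.analyticOnNhd hUo)
      ((hd.add (by fun_prop : DifferentiableOn ℂ (fun z : ℂ => (z - 1) / 2 + 1) U)).analyticOnNhd
        hUo) hUc ⟨by simp; norm_num, by simp [hR]; linarith [norm_nonneg s]⟩ (by
        have h2 : {z : ℂ | 1 < z.re} ∈ 𝓝 (2 : ℂ) :=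
          (isOpen_lt continuous_const continuous_re).mem_nhds (by simp)
        filter_upwards [h2] with z hz
        simp only [Pi.add_apply]
        rw [(hasSum_zetaTrapezoidTerm hz).tsum_eq]
        ring)
    exact hEq ⟨by simp only [mem_ofPred_eq]; linarith, by simp [hR]⟩
  have hsum : ‖∑' n, zetaTrapezoidTerm n s‖
      ≤ (1 + ‖s‖) ^ 3 * ∑' n : ℕ, ((n + 1 : ℕ) : ℝ) ^ (-5 / 4 : ℝ) := by
    rw [← tsum_mul_left]
    exact tsum_of_norm_bounded (hu.mul_left _).hasSum fun n => hle n s (by linarith)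
  have h1 : ‖(s - 1) / 2 + 1‖ ≤ 2 * (1 + ‖s‖) ^ 3 := by
    have h2 : ‖(s - 1) / 2 + 1‖ ≤ ‖s‖ + 1 := by
      rw [show (s - 1) / 2 + 1 = (s + 1) / 2 by ring, norm_div]
      have := norm_add_le s 1
      simp at this ⊢
      linarith [norm_nonneg s]
    nlinarith [norm_nonneg s, pow_nonneg (norm_nonneg s) 2, pow_nonneg (norm_nonneg s) 3]
  rw [heq]
  refine (norm_add_le _ _).trans ?_
  linarith

lemma norm_inv_riemannZeta_le : ∃ M : ℝ, ∀ s : ℂ, 3 / 2 ≤ s.re → ‖(riemannZeta s)⁻¹‖ ≤ M := by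
  have hsum := (ArithmeticFunction.LSeriesSummable_moebius_iff (s := (3 / 2 : ℝ))).2
    (by rw [ofReal_re]; norm_num)
  refine ⟨∑' n, ‖LSeries.term (fun n => (ArithmeticFunction.moebius n : ℂ)) (3 / 2 : ℝ) n‖,
    fun s hs => ?_⟩
  have h := LSeries_one_mul_Lseries_moebius (s := s) (by linarith)
  rw [LSeries_one_eq_riemannZeta (by linarith)] at h
  rw [inv_eq_of_mul_eq_one_right h, LSeries]
  exact tsum_of_norm_bounded hsum.norm.hasSum fun n =>
    LSeries.norm_term_le_of_re_le_re _ (by rwa [ofReal_re]) n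

lemma norm_riemannZeta_le : ∃ M : ℝ, ∀ s : ℂ, 3 / 2 ≤ s.re → ‖riemannZeta s‖ ≤ M := by
  have hsum := (LSeriesSummable_one_iff (s := (3 / 2 : ℝ))).2
    (by rw [ofReal_re]; norm_num)
  refine ⟨∑' n, ‖LSeries.term 1 (3 / 2 : ℝ) n‖, fun s hs => ?_⟩
  rw [← LSeries_one_eq_riemannZeta (by linarith), LSeries]
  exact tsum_of_norm_bounded hsum.norm.hasSum fun n =>
    LSeries.norm_term_le_of_re_le_re _ (by rwa [ofReal_re]) n

/-- On the line `Re s = -1/2` the functional equation compares `ζ s` with `ζ (s + 2)`, because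
`1 - s` and `s + 2` are complex conjugates there. -/
lemma norm_riemannZeta_of_re_eq_neg_half {s : ℂ} (hs : s.re = -1 / 2) :
    2 * Real.pi * ‖riemannZeta s‖ = ‖s‖ * ‖riemannZeta (s + 2)‖ := by
  have hs0 : s ≠ 0 := by rintro rfl; norm_num at hs
  have hs2 : s + 2 ≠ 0 := by
    intro h
    have := congrArg re h
    simp [hs] at this
    norm_num at this
  have hG2 : Gammaℝ (s + 2) ≠ 0 := Gammaℝ_ne_zero_of_re_pos (by simp [hs]; norm_num)
  have hadd := Gammaℝ_add_two hs0
  have hG : Gammaℝ s ≠ 0 := by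
    intro h
    rw [h] at hadd
    simp at hadd
    exact hG2 hadd
  have hconj : 1 - s = conj (s + 2) := by
    apply Complex.ext
    · simp [hs]; norm_num
    · simp
  have hz1 : (1 - s) ≠ 0 := by
    rw [hconj]
    exact (map_ne_zero _).2 hs2
  have hGc : Gammaℝ (conj (s + 2)) = conj (Gammaℝ (s + 2)) := by
    have hexp : -conj (s + 2) / 2 = conj (-(s + 2) / 2) := by
      rw [map_div₀, map_neg, map_ofNat]
    rw [Gammaℝ_def, Gammaℝ_def, map_mul, ← Gamma_conj, hexp, cpow_conj, conj_ofReal, map_div₀,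
      map_ofNat]
    · rw [arg_ofReal_of_nonneg Real.pi_pos.le]
      exact Real.pi_pos.ne
  have h1 : completedRiemannZeta s = riemannZeta s * Gammaℝ s := by
    rw [riemannZeta_def_of_ne_zero hs0, div_mul_cancel₀ _ hG]
  have h2 : completedRiemannZeta (1 - s) = conj (riemannZeta (s + 2) * Gammaℝ (s + 2)) := by
    rw [map_mul, ← hGc, ← riemannZeta_conj, ← hconj, riemannZeta_def_of_ne_zero hz1,
      div_mul_cancel₀]
    rw [hconj, hGc]
    simpa using hG2
  rw [completedRiemannZeta_one_sub, h1] at h2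
  have h3 := congrArg norm h2
  rw [Complex.norm_conj, norm_mul, norm_mul, hadd, norm_div, norm_div, norm_mul, Complex.norm_real,
    Real.norm_of_nonneg Real.pi_pos.le, RCLike.norm_ofNat] at h3
  have hGn : 0 < ‖Gammaℝ s‖ := norm_pos_iff.2 hG
  have hpi := Real.pi_pos
  field_simp at h3
  linarith

/-- The quotient `ξ (w - 1/2) / ξ (w + 3/2)`, in which the Gamma factors cancel to a rational
function. -/
noncomputable def xiShiftQuotient (w : ℂ) : ℂ :=
  2 * Real.pi * riemannZeta₁ (w - 1 / 2) / ((w + 1 / 2) * (w + 3 / 2))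
    * (riemannZeta (w + 3 / 2))⁻¹

lemma differentiableOn_xiShiftQuotient :
    DifferentiableOn ℂ xiShiftQuotient {w | -1 / 2 < w.re} := by
  intro w hw
  simp only [mem_ofPred_eq] at hw
  have h1 : w + 1 / 2 ≠ 0 := fun h => by
    have := congrArg re h
    norm_num at this
    linarith
  have h2 : w + 3 / 2 ≠ 0 := fun h => by
    have := congrArg re h
    norm_num at this
    linarith
  have h3 : w + 3 / 2 ≠ 1 := fun h => by
    have := congrArg re h
    norm_num at this
    linarith
  have h4 : riemannZeta (w + 3 / 2) ≠ 0 :=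
    riemannZeta_ne_zero_of_one_le_re (by norm_num; linarith)
  have h5 : DifferentiableAt ℂ (fun w : ℂ => riemannZeta (w + 3 / 2)) w :=
    DifferentiableAt.comp w (differentiableAt_riemannZeta h3) (by fun_prop)
  have h6 : DifferentiableAt ℂ (fun w : ℂ => riemannZeta₁ (w - 1 / 2)) w :=
    DifferentiableAt.comp (g := riemannZeta₁) w differentiable_riemannZeta₁.differentiableAt
      (by fun_prop)
  have h7 : DifferentiableAt ℂ (fun w : ℂ => (w + 1 / 2) * (w + 3 / 2)) w := by fun_prop
  exact (((h6.const_mul (2 * Real.pi : ℂ)).div h7 (mul_ne_zero h1 h2)).mul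
    (h5.inv h4)).differentiableWithinAt

lemma norm_xiShiftQuotient (w : ℂ) : ‖xiShiftQuotient w‖ =
    2 * Real.pi * ‖riemannZeta₁ (w - 1 / 2)‖ / (‖w + 1 / 2‖ * ‖w + 3 / 2‖)
      * ‖(riemannZeta (w + 3 / 2))⁻¹‖ := by
  rw [xiShiftQuotient, norm_mul, norm_div, norm_mul, norm_mul, norm_mul, Complex.norm_real,
    Real.norm_of_nonneg Real.pi_pos.le, RCLike.norm_ofNat]

lemma le_norm_add_ofReal {w : ℂ} (hw : 0 ≤ w.re) (c : ℝ) : c ≤ ‖w + c‖ := by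
  have h := (le_abs_self _).trans (Complex.abs_re_le_norm (w + c))
  simp only [add_re, ofReal_re] at h
  linarith

lemma xiShiftQuotient_isBigO : ∃ c < (2 : ℝ), ∃ B, xiShiftQuotient
    =O[cobounded ℂ ⊓ 𝓟 {z | 0 < z.re}] fun z => Real.exp (B * ‖z‖ ^ c) := by
  obtain ⟨K, hK⟩ := norm_riemannZeta₁_le
  obtain ⟨M, hM⟩ := norm_inv_riemannZeta_le
  refine ⟨1, by norm_num, 1,
    IsBigO.of_bound (2 * Real.pi * (6 * K * Real.exp 2) / (1 / 2 * (3 / 2)) * M) ?_⟩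
  refine eventually_inf_principal.2 (Eventually.of_forall fun w hw => ?_)
  simp only [mem_ofPred_eq] at hw
  have hKn : 0 ≤ K := by
    have := (norm_nonneg _).trans (hK 0 (by simp; norm_num))
    simpa using this
  have hMn : 0 ≤ M := (norm_nonneg _).trans (hM 2 (by simp; norm_num))
  have h1 : ‖riemannZeta₁ (w - 1 / 2)‖ ≤ 6 * K * Real.exp 2 * Real.exp ‖w‖ := by
    refine (hK _ (by norm_num; linarith)).trans ?_
    have h2 : ‖w - 1 / 2‖ ≤ ‖w‖ + 1 := by
      refine (norm_sub_le _ _).trans ?_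
      norm_num
    have h3 := Real.pow_div_factorial_le_exp (x := 2 + ‖w‖) (by positivity) 3
    rw [Real.exp_add] at h3
    norm_num [Nat.factorial] at h3
    have h4 : (1 + ‖w - 1 / 2‖) ^ 3 ≤ (2 + ‖w‖) ^ 3 := by
      exact pow_le_pow_left₀ (by positivity) (by linarith) 3
    calc _ ≤ K * (6 * (Real.exp 2 * Real.exp ‖w‖)) := by
          gcongr
          linarith
      _ = _ := by ring
  have h2 : 1 / 2 ≤ ‖w + 1 / 2‖ := by
    simpa using le_norm_add_ofReal hw.le (1 / 2)
  have h3 : 3 / 2 ≤ ‖w + 3 / 2‖ := by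
    simpa using le_norm_add_ofReal hw.le (3 / 2)
  have h4 := hM (w + 3 / 2) (by norm_num; linarith)
  rw [norm_xiShiftQuotient, Real.norm_of_nonneg (Real.exp_pos _).le, Real.rpow_one, one_mul]
  have hpi := Real.pi_pos
  calc _ ≤ 2 * Real.pi * (6 * K * Real.exp 2 * Real.exp ‖w‖) / (1 / 2 * (3 / 2)) * M := by
        gcongr
    _ = _ := by ring

lemma xiShiftQuotient_isBoundedUnder :
    IsBoundedUnder (· ≤ ·) atTop (fun x : ℝ => ‖xiShiftQuotient x‖) := by
  obtain ⟨K, hK⟩ := norm_riemannZeta_le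
  obtain ⟨M, hM⟩ := norm_inv_riemannZeta_le
  have hKn : 0 ≤ K := (norm_nonneg _).trans (hK 2 (by simp; norm_num))
  have hpi := Real.pi_pos
  refine ⟨2 * Real.pi * K * M, ?_⟩
  rw [eventually_map]
  filter_upwards [eventually_ge_atTop (2 : ℝ)] with x hx
  have h1 : (x : ℂ) - 1 / 2 ≠ 1 := fun h => by
    have := congrArg re h
    norm_num at this
    linarith
  have h2 : riemannZeta₁ ((x : ℂ) - 1 / 2)
      = ((x - 3 / 2 : ℝ) : ℂ) * riemannZeta ((x : ℂ) - 1 / 2) := by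
    have : ((x - 3 / 2 : ℝ) : ℂ) = (x : ℂ) - 1 / 2 - 1 := by push_cast; ring
    rw [riemannZeta_eq_inv_sub_mul h1, this, mul_inv_cancel_left₀ (sub_ne_zero.2 h1)]
  have h3 := hK ((x : ℂ) - 1 / 2) (by norm_num; linarith)
  have h4 := hM ((x : ℂ) + 3 / 2) (by norm_num; linarith)
  have h5 : ‖(x : ℂ) + 1 / 2‖ = x + 1 / 2 := by
    rw [show (x : ℂ) + 1 / 2 = ((x + 1 / 2 : ℝ) : ℂ) by push_cast; ring, Complex.norm_real,
      Real.norm_of_nonneg (by linarith)]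
  have h6 : ‖(x : ℂ) + 3 / 2‖ = x + 3 / 2 := by
    rw [show (x : ℂ) + 3 / 2 = ((x + 3 / 2 : ℝ) : ℂ) by push_cast; ring, Complex.norm_real,
      Real.norm_of_nonneg (by linarith)]
  rw [norm_xiShiftQuotient, h2, norm_mul, Complex.norm_real, Real.norm_of_nonneg (by linarith), h5,
    h6]
  gcongr
  rw [div_le_iff₀ (by positivity)]
  have h7 : (x - 3 / 2) * ‖riemannZeta ((x : ℂ) - 1 / 2)‖ ≤ ((x + 1 / 2) * (x + 3 / 2)) * K := by
    have : x - 3 / 2 ≤ (x + 1 / 2) * (x + 3 / 2) := by nlinarith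
    gcongr
  calc _ ≤ 2 * Real.pi * (((x + 1 / 2) * (x + 3 / 2)) * K) := by gcongr
    _ = _ := by ring

lemma norm_xiShiftQuotient_imaginary (t : ℝ) : ‖xiShiftQuotient (t * I)‖ ≤ 1 := by
  set s : ℂ := t * I - 1 / 2 with hs
  have hre : s.re = -1 / 2 := by simp [hs]; norm_num
  have hs1 : s ≠ 1 := fun h => by
    rw [h] at hre
    norm_num at hre
  have hz := norm_riemannZeta_of_re_eq_neg_half hre
  have h2 : riemannZeta₁ s = (s - 1) * riemannZeta s := by
    rw [riemannZeta_eq_inv_sub_mul hs1, mul_inv_cancel_left₀ (sub_ne_zero.2 hs1)]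
  have e1 : (t * I : ℂ) + 1 / 2 = - conj s := by
    apply Complex.ext <;> simp [hs]
  have e2 : (t * I : ℂ) + 3 / 2 = - conj (s - 1) := by
    apply Complex.ext <;> simp [hs]; norm_num
  have e3 : (t * I : ℂ) + 3 / 2 = s + 2 := by
    rw [hs]; ring
  have hs0 : 0 < ‖s‖ := norm_pos_iff.2 (by rintro h; rw [h] at hre; norm_num at hre)
  have hs10 : 0 < ‖s - 1‖ := norm_pos_iff.2 (sub_ne_zero.2 hs1)
  have hz2 : 0 < ‖riemannZeta (s + 2)‖ := norm_pos_iff.2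
    (riemannZeta_ne_zero_of_one_le_re (by simp [hre]; norm_num))
  rw [norm_xiShiftQuotient, ← hs, h2, e1, norm_neg, Complex.norm_conj]
  nth_rw 1 [e2]
  rw [e3, norm_neg, Complex.norm_conj, norm_mul, norm_inv]
  refine le_of_eq ?_
  field_simp
  linarith

lemma norm_xiShiftQuotient_half : ‖xiShiftQuotient (1 / 2)‖ = 3 / Real.pi := by
  have h1 : riemannZeta₁ 0 = 1 / 2 := by
    have := riemannZeta_eq_inv_sub_mul (s := 0) (by simp)
    rw [riemannZeta_zero] at this
    norm_num at this
    linear_combination -this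
  have h2 : (1 / 2 + 3 / 2 : ℂ) = ((2 : ℝ) : ℂ) := by norm_num
  have hpi := Real.pi_pos
  have h3 : riemannZeta ((2 : ℝ) : ℂ) = ((Real.pi ^ 2 / 6 : ℝ) : ℂ) := by
    push_cast
    exact riemannZeta_two
  rw [norm_xiShiftQuotient, sub_self, h1, h2, h3, norm_inv, Complex.norm_real, Complex.norm_real,
    Real.norm_of_nonneg (by positivity)]
  norm_num
  field_simp
  norm_num

lemma prod_norm_one_add_le {F : Finset ℂ} (hF : ∀ ρ ∈ F, 0 < ρ.re ∧ riemannZeta ρ = 0) :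
    3 / Real.pi * ∏ ρ ∈ F, ‖1 + ρ‖ ≤ ∏ ρ ∈ F, ‖ρ‖ := by
  have h := norm_mul_prod_le_of_zeros (U := {w | -1 / 2 < w.re}) (C := 1)
    (isOpen_lt continuous_const continuous_re)
    (fun z hz => by simp only [mem_ofPred_eq]; linarith) (F.map (addRightEmbedding (1 / 2)))
    (by
      intro a ha
      obtain ⟨ρ, hρ, rfl⟩ := Finset.mem_map.1 ha
      have := (hF ρ hρ).1
      norm_num
      linarith) xiShiftQuotient differentiableOn_xiShiftQuotient xiShiftQuotient_isBigO
    xiShiftQuotient_isBoundedUnder norm_xiShiftQuotient_imaginary (by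
      intro a ha
      obtain ⟨ρ, hρ, rfl⟩ := Finset.mem_map.1 ha
      have h1 : ρ ≠ 1 := by
        rintro rfl
        exact riemannZeta_one_ne_zero (hF 1 hρ).2
      have h2 : riemannZeta₁ ρ = 0 := by
        have := (hF ρ hρ).2
        rw [riemannZeta_eq_inv_sub_mul h1] at this
        exact (mul_eq_zero.1 this).resolve_left (inv_ne_zero (sub_ne_zero.2 h1))
      simp [xiShiftQuotient, h2]) (1 / 2) (by norm_num)
  rw [norm_xiShiftQuotient_half, one_mul, Finset.prod_map, Finset.prod_map] at h
  have e1 : ∀ ρ : ℂ, ‖1 / 2 + conj ((addRightEmbedding (1 / 2)) ρ)‖ = ‖1 + ρ‖ := fun ρ => by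
    rw [← Complex.norm_conj (1 + ρ)]
    congr 1
    simp [map_ofNat]
    ring
  have e2 : ∀ ρ : ℂ, ‖1 / 2 - (addRightEmbedding (1 / 2)) ρ‖ = ‖ρ‖ := fun ρ => by simp
  simpa only [e1, e2] using h

/-- The two reflected Blaschke factors of `ρ` and `1 - conj ρ` at the point `0`, combined. -/
lemma one_add_mul_norm_le {ρ : ℂ} (h0 : 0 < ρ.re) (h1 : ρ.re < 1) :
    (1 + 4 / (1 + ρ.im ^ 2)) * (‖ρ‖ * ‖1 - ρ‖) ^ 2 ≤ (‖1 + ρ‖ * ‖2 - ρ‖) ^ 2 := by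
  simp only [mul_pow, Complex.sq_norm, normSq_apply]
  simp only [sub_re, add_re, one_re, re_ofNat, sub_im, add_im, one_im, im_ofNat]
  set b := ρ.re
  set g := ρ.im
  have hD : 0 < 1 + g ^ 2 := by positivity
  rw [one_add_div hD.ne', div_mul_eq_mul_div, div_le_iff₀ hD]
  set A := b * b + g * g with hA
  set B := (1 - b) * (1 - b) + (0 - g) * (0 - g) with hB
  have hA1 : A ≤ 1 + g ^ 2 := by nlinarith
  have hB1 : B ≤ 1 + g ^ 2 := by nlinarith
  have hA0 : 0 ≤ A := by nlinarith
  have hB0 : 0 ≤ B := by nlinarith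
  have e1 : (1 + b) * (1 + b) + (0 + g) * (0 + g) = A + (1 + 2 * b) := by rw [hA]; ring
  have e2 : (2 - b) * (2 - b) + (0 - g) * (0 - g) = B + (3 - 2 * b) := by rw [hB]; ring
  rw [e1, e2]
  have h3 : 0 ≤ (1 + g ^ 2 - A) * ((3 - 2 * b) * B) := by
    have : 0 ≤ 3 - 2 * b := by linarith
    exact mul_nonneg (by linarith) (by positivity)
  have h4 : A * ((3 - 2 * b) * (1 + g ^ 2)) ≥ A * ((3 - 2 * b) * B) := by
    have : 0 ≤ 3 - 2 * b := by linarith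
    gcongr
  have h5 : B * ((1 + 2 * b) * (1 + g ^ 2)) ≥ B * ((1 + 2 * b) * A) := by
    gcongr
  have h6 : 0 ≤ (1 + 2 * b) * (3 - 2 * b) * (1 + g ^ 2) :=
    mul_nonneg (mul_nonneg (by linarith) (by linarith)) hD.le
  nlinarith

lemma one_add_sum_le_prod_one_add {ι : Type*} (F : Finset ι) {y : ι → ℝ} (hy : ∀ i, 0 ≤ y i) :
    1 + ∑ i ∈ F, y i ≤ ∏ i ∈ F, (1 + y i) := by
  classical
  induction F using Finset.induction_on with
  | empty => simp
  | insert a F ha ih =>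
    rw [Finset.sum_insert ha, Finset.prod_insert ha]
    have h1 : 0 ≤ ∑ i ∈ F, y i := Finset.sum_nonneg fun i _ => hy i
    nlinarith [hy a]

lemma riemannZeta_one_sub_conj_eq_zero {ρ : ℂ} (hρ : riemannZeta ρ = 0) (h0 : 0 < ρ.re)
    (h1 : ρ.re < 1) : riemannZeta (1 - conj ρ) = 0 := by
  have hz : riemannZeta (conj ρ) = 0 := by rw [riemannZeta_conj, hρ, map_zero]
  rw [riemannZeta_one_sub, hz, mul_zero]
  · intro n h
    have := congrArg re h
    simp at this
    linarith [n.cast_nonneg (α := ℝ)]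
  · intro h
    have := congrArg re h
    simp at this
    linarith

/-- The nontrivial zeros of the Riemann zeta function satisfy
`∑ 4 / (1 + γ ^ 2) ≤ (π / 3) ^ 4 - 1`. -/
lemma sum_four_div_one_add_sq_im_le {F : Finset ℂ}
    (hF : ∀ ρ ∈ F, riemannZeta ρ = 0 ∧ 0 < ρ.re ∧ ρ.re < 1) :
    ∑ ρ ∈ F, 4 / (1 + ρ.im ^ 2) ≤ (Real.pi / 3) ^ 4 - 1 := by
  classical
  set G := F ∪ F.image (fun ρ => 1 - conj ρ) with hGdef
  have hG : ∀ ρ ∈ G, riemannZeta ρ = 0 ∧ 0 < ρ.re ∧ ρ.re < 1 := by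
    intro ρ hρ
    rcases Finset.mem_union.1 hρ with h | h
    · exact hF ρ h
    · obtain ⟨τ, hτ, rfl⟩ := Finset.mem_image.1 h
      obtain ⟨h1, h2, h3⟩ := hF τ hτ
      refine ⟨riemannZeta_one_sub_conj_eq_zero h1 h2 h3, ?_, ?_⟩ <;> simp <;> linarith
  have hrefl : ∀ ρ ∈ G, 1 - conj ρ ∈ G := by
    intro ρ hρ
    rcases Finset.mem_union.1 hρ with h | h
    · exact Finset.mem_union_right _ (Finset.mem_image_of_mem _ h)
    · obtain ⟨τ, hτ, rfl⟩ := Finset.mem_image.1 h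
      refine Finset.mem_union_left _ ?_
      simpa using hτ
  have hre : ∀ f : ℂ → ℝ, ∏ ρ ∈ G, f (1 - conj ρ) = ∏ ρ ∈ G, f ρ := fun f =>
    Finset.prod_nbij' (fun ρ => 1 - conj ρ) (fun ρ => 1 - conj ρ) hrefl hrefl
      (by simp) (by simp) (by simp)
  have hpi := Real.pi_pos
  have hmain := prod_norm_one_add_le (F := G) fun ρ hρ => ⟨(hG ρ hρ).2.1, (hG ρ hρ).1⟩
  rw [div_mul_eq_mul_div, div_le_iff₀ hpi] at hmain
  set P := ∏ ρ ∈ G, ‖ρ‖ with hP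
  set S := ∏ ρ ∈ G, ‖1 + ρ‖ with hS
  have hPpos : 0 < P := Finset.prod_pos fun ρ hρ => norm_pos_iff.2 (by
    rintro rfl
    simpa using (hG 0 hρ).2.1)
  have hSnonneg : 0 ≤ S := Finset.prod_nonneg fun ρ _ => norm_nonneg _
  have hP' : ∏ ρ ∈ G, ‖1 - ρ‖ = P := by
    rw [hP, ← hre (fun ρ => ‖ρ‖)]
    refine Finset.prod_congr rfl fun ρ _ => ?_
    rw [← Complex.norm_conj (1 - ρ)]
    simp
  have hS' : ∏ ρ ∈ G, ‖2 - ρ‖ = S := by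
    rw [hS, ← hre (fun ρ => ‖1 + ρ‖)]
    refine Finset.prod_congr rfl fun ρ _ => ?_
    rw [← Complex.norm_conj (2 - ρ), map_sub, map_ofNat]
    congr 1
    ring
  have hprod : (∏ ρ ∈ G, (1 + 4 / (1 + ρ.im ^ 2))) * (P * P) ^ 2 ≤ (S * S) ^ 2 := by
    nth_rw 2 [← hP']
    nth_rw 2 [← hS']
    rw [hP, hS, ← Finset.prod_mul_distrib, ← Finset.prod_mul_distrib, ← Finset.prod_pow,
      ← Finset.prod_pow, ← Finset.prod_mul_distrib]
    exact Finset.prod_le_prod (fun ρ _ => by positivity)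
      fun ρ hρ => one_add_mul_norm_le (hG ρ hρ).2.1 (hG ρ hρ).2.2
  have hS4 : (S * S) ^ 2 ≤ (Real.pi / 3) ^ 4 * (P * P) ^ 2 := by
    have h1 : S ≤ Real.pi / 3 * P := by linarith
    calc (S * S) ^ 2 = S ^ 4 := by ring
      _ ≤ (Real.pi / 3 * P) ^ 4 := by gcongr
      _ = _ := by ring
  have hle := le_of_mul_le_mul_right (hprod.trans hS4) (by positivity)
  have hone := one_add_sum_le_prod_one_add G (y := fun ρ : ℂ => 4 / (1 + ρ.im ^ 2))
    fun ρ => by positivity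
  have hsub : ∑ ρ ∈ F, 4 / (1 + ρ.im ^ 2) ≤ ∑ ρ ∈ G, 4 / (1 + ρ.im ^ 2) :=
    Finset.sum_le_sum_of_subset_of_nonneg Finset.subset_union_left fun ρ _ _ => by positivity
  linarith

theorem stmt_15 (N : ℝ → ℝ)
    (hN : ∀ u : ℝ, N u =
      Nat.card {s : ℂ // riemannZeta s = 0 ∧ 0 < s.re ∧ s.re < 1 ∧ 0 < s.im ∧ s.im ≤ u})
    (hB : ∀ u : ℝ, 14.134725146 ≤ u →
      |N u - u / (2 * Real.pi) * Real.log (u / (2 * Real.pi * Real.exp 1))|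
        ≤ 0.137 * Real.log u + 0.443 * Real.log (Real.log u) + 5.225) :
    ∑' ρ : {s : ℂ // riemannZeta s = 0 ∧ 0 < s.re ∧ s.re < 1 ∧ 1 ≤ |s.im|},
      1 / (ρ : ℂ).im ^ 2 ≤ 0.098178 := by
  have hpi : (Real.pi / 3) ^ 4 - 1 ≤ 0.21 := by
    have h1 : Real.pi / 3 ≤ 1.0472 := by
      have := Real.pi_lt_d4
      linarith
    have h2 : (Real.pi / 3) ^ 4 ≤ 1.0472 ^ 4 := by
      gcongr
    norm_num at h2 ⊢
    linarith
  refine Real.tsum_le_of_sum_le (fun ρ => by positivity) fun T => ?_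
  have hsum := (sum_four_div_one_add_sq_im_le (F := T.map (Function.Embedding.subtype _)) (by
    intro ρ hρ
    obtain ⟨τ, _, rfl⟩ := Finset.mem_map.1 hρ
    exact ⟨τ.2.1, τ.2.2.1, τ.2.2.2.1⟩)).trans hpi
  rw [Finset.sum_map] at hsum
  simp only [Function.Embedding.subtype_apply] at hsum
  have hterm : ∀ ρ ∈ T, 1 / (ρ : ℂ).im ^ 2 ≤ 0.27 * (4 / (1 + (ρ : ℂ).im ^ 2)) := by
    intro ρ hρ
    have h1 : 4 / (1 + (ρ : ℂ).im ^ 2) ≤ 0.21 :=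
      (Finset.single_le_sum (f := fun ρ : {s : ℂ // riemannZeta s = 0 ∧ 0 < s.re ∧ s.re < 1 ∧
        1 ≤ |s.im|} => 4 / (1 + (ρ : ℂ).im ^ 2)) (fun _ _ => by positivity) hρ).trans hsum
    rw [div_le_iff₀ (by positivity)] at h1
    rw [← mul_div_assoc, div_le_div_iff₀ (by linarith) (by positivity)]
    linarith
  calc _ ≤ ∑ ρ ∈ T, 0.27 * (4 / (1 + (ρ : ℂ).im ^ 2)) := Finset.sum_le_sum hterm
    _ = 0.27 * ∑ ρ ∈ T, 4 / (1 + (ρ : ℂ).im ^ 2) := by rw [Finset.mul_sum]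
    _ ≤ 0.27 * 0.21 := by gcongr
    _ ≤ 0.098178 := by norm_num
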